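/- Let R₀ be an invertible k×k real matrix, s a 1×k real row vector, t a real scalar with γ := t − s R₀⁻¹ sᵀ ≠ 0, C₀ a k×r real matrix, u a 1×r real row vector, and Q an invertible r×r real matrix such that W₀ := C₀ᵀ R₀⁻¹ C₀ + Q⁻¹ is invertible. Set R₁ = [[R₀, sᵀ], [s, t]] and let C₁ be C₀ with the row u appended. Then det(C₁ᵀ R₁⁻¹ C₁ + Q⁻¹) = (1 + (1/γ) (s R₀⁻¹ C₀ − u) W₀⁻¹ (C₀ᵀ R₀⁻¹ sᵀ − uᵀ)) · det(W₀). -/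

import Mathlib

open Matrix

/-- Determinant update for the greedy step: with `W₀ = C₀ᵀ R₀⁻¹ C₀ + Q⁻¹` invertible,
`R₁ = [[R₀, sᵀ], [s, t]]`, Schur complement `γ = t − s R₀⁻¹ sᵀ ≠ 0`, and `C₁` obtained
from `C₀` by appending the row `u`,
`det(C₁ᵀ R₁⁻¹ C₁ + Q⁻¹) = (1 + γ⁻¹ (s R₀⁻¹ C₀ − u) W₀⁻¹ (C₀ᵀ R₀⁻¹ sᵀ − uᵀ)) · det W₀`. -/
theorem stmt_7 {k r : ℕ}
    (R₀ : Matrix (Fin k) (Fin k) ℝ) (hR₀ : IsUnit R₀.det)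
    (s : Matrix (Fin 1) (Fin k) ℝ) (t : ℝ)
    (γ : ℝ) (hγ : γ = t - (s * R₀⁻¹ * sᵀ) 0 0) (hγ0 : γ ≠ 0)
    (C₀ : Matrix (Fin k) (Fin r) ℝ) (u : Matrix (Fin 1) (Fin r) ℝ)
    (Q : Matrix (Fin r) (Fin r) ℝ) (hQ : IsUnit Q.det)
    (W₀ : Matrix (Fin r) (Fin r) ℝ) (hW₀ : W₀ = C₀ᵀ * R₀⁻¹ * C₀ + Q⁻¹)
    (hW₀inv : IsUnit W₀.det)
    (R₁ : Matrix (Fin k ⊕ Fin 1) (Fin k ⊕ Fin 1) ℝ)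
    (hR₁ : R₁ = fromBlocks R₀ sᵀ s (t • (1 : Matrix (Fin 1) (Fin 1) ℝ)))
    (C₁ : Matrix (Fin k ⊕ Fin 1) (Fin r) ℝ) (hC₁ : C₁ = fromRows C₀ u) :
    (C₁ᵀ * R₁⁻¹ * C₁ + Q⁻¹).det
      = (1 + γ⁻¹ * ((s * R₀⁻¹ * C₀ - u) * W₀⁻¹ * (C₀ᵀ * R₀⁻¹ * sᵀ - uᵀ)) 0 0)
          * W₀.det := by
  have hS : s * (R₀⁻¹ * sᵀ) = (t - γ) • (1 : Matrix (Fin 1) (Fin 1) ℝ) := by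
    rw [← Matrix.mul_assoc]
    ext i j
    fin_cases i; fin_cases j
    simp [hγ]
  have hinv : R₁⁻¹ = fromBlocks (R₀⁻¹ + γ⁻¹ • (R₀⁻¹ * sᵀ * (s * R₀⁻¹)))
      (-(γ⁻¹ • (R₀⁻¹ * sᵀ))) (-(γ⁻¹ • (s * R₀⁻¹))) (γ⁻¹ • 1) := by
    apply Matrix.inv_eq_right_inv
    rw [hR₁, fromBlocks_multiply, ← fromBlocks_one]
    have h1 : R₀ * (R₀⁻¹ * sᵀ) = sᵀ := Matrix.mul_nonsing_inv_cancel_left _ _ hR₀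
    have h2 : R₀ * R₀⁻¹ = 1 := Matrix.mul_nonsing_inv _ hR₀
    congr 1
    · rw [Matrix.mul_add, Matrix.mul_smul, ← Matrix.mul_assoc R₀ (R₀⁻¹ * sᵀ), h1, h2,
        Matrix.mul_neg, Matrix.mul_smul]
      abel
    · rw [Matrix.mul_neg, Matrix.mul_smul, h1, Matrix.mul_smul, Matrix.mul_one]
      abel
    · rw [Matrix.mul_add, Matrix.mul_smul, ← Matrix.mul_assoc s (R₀⁻¹ * sᵀ), hS,
        Matrix.mul_neg, Matrix.mul_smul, Matrix.smul_mul, Matrix.smul_mul, Matrix.one_mul]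
      generalize s * R₀⁻¹ = X
      ext i j
      simp
      field_simp
      ring
    · rw [Matrix.mul_neg, Matrix.mul_smul, hS, Matrix.mul_smul, Matrix.mul_one]
      ext i j
      simp
      field_simp
      ring
  have key : C₁ᵀ * R₁⁻¹ * C₁ + Q⁻¹
      = W₀ + (γ⁻¹ • (C₀ᵀ * R₀⁻¹ * sᵀ - uᵀ)) * (s * R₀⁻¹ * C₀ - u) := by
    rw [hinv, hC₁, hW₀, transpose_fromRows, Matrix.fromCols_mul_fromBlocks,
      Matrix.fromCols_mul_fromRows]
    simp only [Matrix.mul_add, Matrix.add_mul, Matrix.mul_sub, Matrix.sub_mul, Matrix.mul_neg,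
      Matrix.neg_mul, Matrix.mul_smul, Matrix.smul_mul, Matrix.mul_one, Matrix.mul_assoc,
      smul_sub]
    abel
  rw [key, Matrix.det_add_mul _ _ hW₀inv, mul_comm, Matrix.mul_smul]
  congr 1
  simp
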